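/- Let V be a finite type, T : ℕ, and live : ℕ → V → V → Prop (live t v w means an active node v succeeds in activating w between times t and t+1). Given a seed finset S ⊆ V, define the active sets A : ℕ → Finset V by A 0 = S and A (t+1) = A t ∪ {w : ∃ v ∈ A t, live t v w} (active nodes remain active). Define the layered live-edge relation ℓ on V × Fin (T+1) by ℓ (v, s) (w, s') ↔ (s' : ℕ) = (s : ℕ) + 1 ∧ (live (s : ℕ) v w ∨ w = v). Then the cumulative number of active nodes equals the spread in the layered graph: ∑_{t=0}^{T} (A t).card = f({(v, 0) : v ∈ S}), where f(S₀) is the cardinality of the reachable set ρ(S₀) = {x | ∃ y ∈ S₀, Relation.ReflTransGen ℓ y x}. -/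

import Mathlib

/-- The set of layered-graph nodes reachable from the seed finset `S₀`. -/
def reachSet {N : Type*} (ℓ : N → N → Prop) (S₀ : Finset N) : Set N :=
  {x : N | ∃ y ∈ S₀, Relation.ReflTransGen ℓ y x}

/-- The spread of a seed finset `S₀`: the cardinality of its reachable set. -/
noncomputable def spread {N : Type*} (ℓ : N → N → Prop) (S₀ : Finset N) : ℕ :=
  (reachSet ℓ S₀).ncard

/-- A layered node `(v, t)` is reachable from the seeds at layer `0` iff `v` is active at
time `t`. -/
theorem mem_reachSet_layered_iff {V : Type*} [DecidableEq V]
    (T : ℕ) (live : ℕ → V → V → Prop) (S : Finset V) (A : ℕ → Finset V)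
    (hA0 : A 0 = S)
    (hAstep : ∀ t : ℕ, ∀ w : V,
      w ∈ A (t + 1) ↔ w ∈ A t ∨ ∃ v ∈ A t, live t v w)
    (x : V × Fin (T + 1)) :
    x ∈ reachSet
        (fun x y : V × Fin (T + 1) =>
          (y.2 : ℕ) = (x.2 : ℕ) + 1 ∧ (live (x.2 : ℕ) x.1 y.1 ∨ y.1 = x.1))
        (S.image (fun v => (v, (0 : Fin (T + 1))))) ↔
      x.1 ∈ A x.2 := by
  constructor
  · rintro ⟨y, hy, hyx⟩
    obtain ⟨v, hv, rfl⟩ := Finset.mem_image.mp hy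
    induction hyx with
    | refl => simpa [hA0] using hv
    | tail _ hstep ih =>
      obtain ⟨htime, hlive | hsame⟩ := hstep
      · rw [htime, hAstep]
        exact Or.inr ⟨_, ih, hlive⟩
      · rw [htime, hAstep, hsame]
        exact Or.inl ih
  · obtain ⟨w, t, ht⟩ := x
    induction t generalizing w with
    | zero =>
      intro hw
      exact ⟨(w, 0), Finset.mem_image_of_mem _ (hA0 ▸ hw), Relation.ReflTransGen.refl⟩
    | succ t ih =>
      intro hw
      rcases (hAstep t w).mp hw with hw | ⟨v, hv, hlive⟩
      · obtain ⟨y, hy, hyw⟩ := ih w (by omega) hw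
        exact ⟨y, hy, hyw.tail ⟨rfl, Or.inr rfl⟩⟩
      · obtain ⟨y, hy, hyv⟩ := ih v (by omega) hv
        exact ⟨y, hy, hyv.tail ⟨rfl, Or.inl hlive⟩⟩

/-- Lemma 1: with active sets `A 0 = S`,
`A (t+1) = A t ∪ {w : ∃ v ∈ A t, live t v w}` (active nodes remain active), and
the layered live-edge relation `ℓ (v, s) (w, s') ↔ s' = s + 1 ∧ (live s v w ∨ w = v)`
on `V × Fin (T+1)`, the cumulative number of active nodes over times `0..T`
equals the spread of `{(v, 0) : v ∈ S}` in the layered graph. -/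
theorem cumulative_eq_layered_spread {V : Type*} [Fintype V] [DecidableEq V]
    (T : ℕ) (live : ℕ → V → V → Prop) (S : Finset V)
    (A : ℕ → Finset V)
    (hA0 : A 0 = S)
    (hAstep : ∀ t : ℕ, ∀ w : V,
      w ∈ A (t + 1) ↔ w ∈ A t ∨ ∃ v ∈ A t, live t v w) :
    (∑ t ∈ Finset.range (T + 1), (A t).card) =
      spread
        (fun x y : V × Fin (T + 1) =>
          (y.2 : ℕ) = (x.2 : ℕ) + 1 ∧ (live (x.2 : ℕ) x.1 y.1 ∨ y.1 = x.1))
        (S.image (fun v => (v, (0 : Fin (T + 1))))) := by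
  have hreach : reachSet
      (fun x y : V × Fin (T + 1) =>
        (y.2 : ℕ) = (x.2 : ℕ) + 1 ∧ (live (x.2 : ℕ) x.1 y.1 ∨ y.1 = x.1))
      (S.image (fun v => (v, (0 : Fin (T + 1))))) =
      ((Finset.univ.filter fun x : V × Fin (T + 1) => x.1 ∈ A x.2 : Finset _) : Set _) := by
    ext x
    simp [mem_reachSet_layered_iff T live S A hA0 hAstep x]
  rw [spread, hreach, Set.ncard_coe_finset, Finset.card_filter, Fintype.sum_prod_type_right,
    Finset.sum_range]
  simp
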